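/- (Cox–Sederberg–Chen structure theorem, uniqueness of representation) Let a,b,c ∈ K[t] with gcd(a,b,c)=1, n = max(deg a, deg b, deg c) ≥ 1, μ = μ(a,b,c), and let (p_x,p_y,p_w), (q_x,q_y,q_w) be a μ-basis: syzygies of degrees μ and n − μ respectively such that every syzygy (A,B,C) of (a,b,c) can be written as h₁·(p_x,p_y,p_w) + h₂·(q_x,q_y,q_w). Then for every nonzero syzygy (A,B,C), any such representation satisfies deg h₁ ≤ deg(A,B,C) − μ and deg h₂ ≤ deg(A,B,C) + μ − n; in particular, if deg(A,B,C) < n − μ then h₂ = 0 and (A,B,C) is a polynomial multiple of (p_x,p_y,p_w). -/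

import Mathlib

open Polynomial
open scoped Classical

/-- The syzygy set of a triple of polynomials. -/
def Syz {K : Type*} [Field K] (a b c : K[X]) : Set (K[X] × K[X] × K[X]) :=
  {p | p.1 * a + p.2.1 * b + p.2.2 * c = 0}

/-- The degree of a triple of polynomials: the max of the (nat) degrees. -/
def triDeg {K : Type*} [Field K] (p : K[X] × K[X] × K[X]) : ℕ :=
  max p.1.natDegree (max p.2.1.natDegree p.2.2.natDegree)

/-- The class `μ(a,b,c)`: minimal degree of a nonzero syzygy. -/
noncomputable def mu {K : Type*} [Field K] (a b c : K[X]) : ℕ :=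
  sInf (Set.image triDeg {p ∈ Syz a b c | p ≠ 0})

/-- A unimodular triple with a μ-basis of its syzygies is a unit multiple of the cross product
of the two basis elements. -/
lemma exists_isUnit_mul_cross {K : Type*} [Field K] {a b c px py pw qx qy qw : K[X]}
    (hgcd : ∃ α β γ : K[X], α * a + β * b + γ * c = 1)
    (hbasis : ∀ s ∈ Syz a b c, ∃ h₁ h₂ : K[X],
      s = (h₁ * px + h₂ * qx, h₁ * py + h₂ * qy, h₁ * pw + h₂ * qw)) :
    ∃ d : K[X], IsUnit d ∧ a = d * (py * qw - pw * qy) ∧ b = d * (pw * qx - px * qw) ∧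
      c = d * (px * qy - py * qx) := by
  obtain ⟨α, β, γ, h⟩ := hgcd
  obtain ⟨e₁, f₁, h₁⟩ := hbasis (0, c, -b) (by simp only [Syz, Set.mem_ofPred_eq]; ring)
  obtain ⟨e₂, f₂, h₂⟩ := hbasis (-c, 0, a) (by simp only [Syz, Set.mem_ofPred_eq]; ring)
  obtain ⟨e₃, f₃, h₃⟩ := hbasis (b, -a, 0) (by simp only [Syz, Set.mem_ofPred_eq]; ring)
  simp only [Prod.mk.injEq] at h₁ h₂ h₃
  obtain ⟨x₁, y₁, w₁⟩ := h₁
  obtain ⟨x₂, y₂, w₂⟩ := h₂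
  obtain ⟨x₃, y₃, w₃⟩ := h₃
  have cross : ∀ {e f e' f' u v u' v' r r' t t' : K[X]}, u = e * r + f * t → v = e * r' + f * t' →
      u' = e' * r + f' * t → v' = e' * r' + f' * t' →
      u * v' - v * u' = (e * f' - f * e') * (r * t' - r' * t) := by
    rintro e f e' f' u v u' v' r r' t t' rfl rfl rfl rfl
    ring
  have key : ∃ d : K[X], a = d * (py * qw - pw * qy) ∧ b = d * (pw * qx - px * qw) ∧
      c = d * (px * qy - py * qx) := by
    refine ⟨α * (e₂ * f₃ - f₂ * e₃) + β * (e₃ * f₁ - f₃ * e₁) + γ * (e₁ * f₂ - f₁ * e₂),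
      ?_, ?_, ?_⟩
    · linear_combination (-a) * h + α * cross y₂ w₂ y₃ w₃ + β * cross y₃ w₃ y₁ w₁ +
        γ * cross y₁ w₁ y₂ w₂
    · linear_combination (-b) * h + α * cross w₂ x₂ w₃ x₃ + β * cross w₃ x₃ w₁ x₁ +
        γ * cross w₁ x₁ w₂ x₂
    · linear_combination (-c) * h + α * cross x₂ y₂ x₃ y₃ + β * cross x₃ y₃ x₁ y₁ +
        γ * cross x₁ y₁ x₂ y₂
  obtain ⟨d, ha, hb, hc⟩ := key
  refine ⟨d, IsUnit.of_mul_eq_one (α * (py * qw - pw * qy) + β * (pw * qx - px * qw) +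
    γ * (px * qy - py * qx)) ?_, ha, hb, hc⟩
  linear_combination h - α * ha - β * hb - γ * hc

/-- If the determinant of two planar polynomial vectors has degree the sum of the degree bounds
of the vectors, then no degree drop occurs in their combinations. -/
lemma natDegree_add_le_of_det {K : Type*} [Field K] {r r' t t' h₁ h₂ : K[X]} {m k N : ℕ}
    (hr : r.natDegree ≤ m) (hr' : r'.natDegree ≤ m) (ht : t.natDegree ≤ k)
    (ht' : t'.natDegree ≤ k) (hdet0 : r * t' - r' * t ≠ 0)
    (hdet : (r * t' - r' * t).natDegree = m + k)
    (hN : (h₁ * r + h₂ * t).natDegree ≤ N) (hN' : (h₁ * r' + h₂ * t').natDegree ≤ N) :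
    (h₁ ≠ 0 → h₁.natDegree + m ≤ N) ∧ (h₂ ≠ 0 → h₂.natDegree + k ≤ N) := by
  constructor <;> intro h0
  · have h : h₁ * (r * t' - r' * t) = (h₁ * r + h₂ * t) * t' - (h₁ * r' + h₂ * t') * t := by ring
    have hd := natDegree_sub_le_of_le (natDegree_mul_le_of_le hN ht')
      (natDegree_mul_le_of_le hN' ht)
    rw [← h, natDegree_mul h0 hdet0] at hd
    omega
  · have h : h₂ * (r * t' - r' * t) = r * (h₁ * r' + h₂ * t') - r' * (h₁ * r + h₂ * t) := by ring
    have hd := natDegree_sub_le_of_le (natDegree_mul_le_of_le hr hN')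
      (natDegree_mul_le_of_le hr' hN)
    rw [← h, natDegree_mul h0 hdet0] at hd
    omega

theorem stmt8 {K : Type*} [Field K] (a b c px py pw qx qy qw : K[X]) (n μ : ℕ)
    (hgcd : gcd a (gcd b c) = 1)
    (hn : n = triDeg (a, b, c)) (hn1 : 1 ≤ n)
    (hμ : μ = mu a b c)
    (hp : (px, py, pw) ∈ Syz a b c) (hpdeg : triDeg (px, py, pw) = μ)
    (hq : (qx, qy, qw) ∈ Syz a b c) (hqdeg : triDeg (qx, qy, qw) = n - μ)
    (hμn : μ ≤ n)
    (hbasis : ∀ s ∈ Syz a b c, ∃ h₁ h₂ : K[X],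
      s = (h₁ * px + h₂ * qx, h₁ * py + h₂ * qy, h₁ * pw + h₂ * qw))
    (hgen : μ = n - μ →
      ∀ c₁ c₂ : K, c₁ • ![px.coeff μ, py.coeff μ, pw.coeff μ] +
          c₂ • ![qx.coeff μ, qy.coeff μ, qw.coeff μ] = 0 → c₁ = 0 ∧ c₂ = 0) :
    ∀ s ∈ Syz a b c, s ≠ 0 → ∀ h₁ h₂ : K[X],
      s = (h₁ * px + h₂ * qx, h₁ * py + h₂ * qy, h₁ * pw + h₂ * qw) →
      (h₁ ≠ 0 → h₁.natDegree + μ ≤ triDeg s) ∧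
      (h₂ ≠ 0 → h₂.natDegree + n ≤ triDeg s + μ) ∧
      (triDeg s < n - μ → h₂ = 0 ∧ s = (h₁ * px, h₁ * py, h₁ * pw)) := by
  rintro s - - h₁ h₂ hs
  have hbez : ∃ α β γ : K[X], α * a + β * b + γ * c = 1 := by
    obtain ⟨x, y, hxy⟩ := exists_gcd_eq_mul_add_mul b c
    obtain ⟨z, w, hzw⟩ := exists_gcd_eq_mul_add_mul a (gcd b c)
    refine ⟨z, w * x, w * y, ?_⟩
    rw [hgcd] at hzw
    linear_combination -hzw - w * hxy
  obtain ⟨d, hd, ha, hb, hc⟩ := exists_isUnit_mul_cross hbez hbasis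
  have hdet : ∀ {u v : K[X]}, u = d * v → u.natDegree = n → v ≠ 0 ∧ v.natDegree = μ + (n - μ) := by
    rintro u v rfl hu
    have hv : v ≠ 0 := by
      rintro rfl
      simp at hu
      omega
    rw [natDegree_mul hd.ne_zero hv, natDegree_eq_zero_of_isUnit hd] at hu
    exact ⟨hv, by omega⟩
  have hbounds : (h₁ ≠ 0 → h₁.natDegree + μ ≤ triDeg s) ∧
      (h₂ ≠ 0 → h₂.natDegree + (n - μ) ≤ triDeg s) := by
    have hN : triDeg s ≤ triDeg s := le_rfl
    nth_rewrite 1 [hs] at hN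
    have hp' := hpdeg.le
    have hq' := hqdeg.le
    simp only [triDeg, max_le_iff] at hN hp' hq'
    obtain ⟨hpx, hpy, hpw⟩ := hp'
    obtain ⟨hqx, hqy, hqw⟩ := hq'
    have hcases : a.natDegree = n ∨ b.natDegree = n ∨ c.natDegree = n := by
      simp only [triDeg] at hn
      omega
    obtain h | h | h := hcases
    · obtain ⟨h0, hX⟩ := hdet ha h
      exact natDegree_add_le_of_det hpy hpw hqy hqw h0 hX hN.2.1 hN.2.2
    · obtain ⟨h0, hX⟩ := hdet hb h
      exact natDegree_add_le_of_det hpw hpx hqw hqx h0 hX hN.2.2 hN.1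
    · obtain ⟨h0, hX⟩ := hdet hc h
      exact natDegree_add_le_of_det hpx hpy hqx hqy h0 hX hN.1 hN.2.1
  refine ⟨hbounds.1, fun h => ?_, fun hlt => ?_⟩
  · have := hbounds.2 h
    omega
  · have h0 : h₂ = 0 := by
      by_contra h
      have := hbounds.2 h
      omega
    exact ⟨h0, by simpa [h0] using hs⟩
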